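/- Let G/K be a generalized flag manifold whose isotropy representation decomposes as 𝔪 = 𝔪₁ ⊕ ⋯ ⊕ 𝔪ₛ with s ≥ 3 pairwise inequivalent irreducible Ad(K)-submodules, and let G/K₁ be the corresponding M-space. If dim 𝔰 = 1 and there exists some j ∈ {1, …, s} such that 𝔪ⱼ is reducible as an Ad(K₁)-module, then (G/K₁, g) is a g.o. space if and only if g is the standard metric. -/

import Mathlib

open Module

/-- A submodule `W` of a Lie algebra is invariant under the (infinitesimal) adjoint action
of the Lie subalgebra `k`.  For a connected Lie group this corresponds to `Ad(K)`-invariance. -/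
def AdInvariant {𝔤 : Type*} [LieRing 𝔤] [LieAlgebra ℝ 𝔤]
    (k : LieSubalgebra ℝ 𝔤) (W : Submodule ℝ 𝔤) : Prop :=
  ∀ x ∈ k, ∀ w ∈ W, ⁅x, w⁆ ∈ W

/-- `W` is a nonzero irreducible module for the adjoint action of `k`
(i.e. an irreducible `Ad(K)`-module). -/
def AdIrreducible {𝔤 : Type*} [LieRing 𝔤] [LieAlgebra ℝ 𝔤]
    (k : LieSubalgebra ℝ 𝔤) (W : Submodule ℝ 𝔤) : Prop :=
  AdInvariant k W ∧ W ≠ ⊥ ∧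
    ∀ U : Submodule ℝ 𝔤, U ≤ W → AdInvariant k U → U = ⊥ ∨ U = W

/-- `W` is a reducible `Ad(K)`-module: invariant, with a proper nonzero invariant submodule. -/
def AdReducible {𝔤 : Type*} [LieRing 𝔤] [LieAlgebra ℝ 𝔤]
    (k : LieSubalgebra ℝ 𝔤) (W : Submodule ℝ 𝔤) : Prop :=
  AdInvariant k W ∧ ∃ U : Submodule ℝ 𝔤, U ≤ W ∧ AdInvariant k U ∧ U ≠ ⊥ ∧ U ≠ W

/-- Equivalence of two `Ad(K)`-modules `U` and `V`: an injective intertwining linear map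
carrying `U` onto `V`. -/
def AdEquiv {𝔤 : Type*} [LieRing 𝔤] [LieAlgebra ℝ 𝔤]
    (k : LieSubalgebra ℝ 𝔤) (U V : Submodule ℝ 𝔤) : Prop :=
  ∃ f : 𝔤 →ₗ[ℝ] 𝔤, Submodule.map f U = V ∧ (∀ u ∈ U, f u = 0 → u = 0) ∧
    ∀ x ∈ k, ∀ u ∈ U, f ⁅x, u⁆ = ⁅x, f u⁆

/-- The g.o. property of the `G`-invariant metric with associated operator `Λ` on the
homogeneous space with isotropy algebra `k` and tangent space `n`: every geodesic through
the origin is homogeneous, i.e. (by the standard criterion) for every `x ∈ n` there is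
`a ∈ k` such that `⁅a + x, Λ x⁆ ∈ k`. -/
def IsGOMetric {𝔤 : Type*} [LieRing 𝔤] [LieAlgebra ℝ 𝔤]
    (k : LieSubalgebra ℝ 𝔤) (n : Submodule ℝ 𝔤) (Λ : 𝔤 →ₗ[ℝ] 𝔤) : Prop :=
  ∀ x ∈ n, ∃ a ∈ k, ⁅a + x, Λ x⁆ ∈ k.toSubmodule

section PosDefForm

variable {E : Type*} [AddCommGroup E] [Module ℝ E]

/-- The inner product on a subspace given by a positive definite symmetric form. -/
abbrev innerCoreOfPosDef (Q : LinearMap.BilinForm ℝ E)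
    (hsymm : ∀ x y, Q x y = Q y x) (hpos : ∀ x, x ≠ 0 → 0 < Q x x) (W : Submodule ℝ E) :
    InnerProductSpace.Core ℝ W where
  inner := fun x y => Q x y
  conj_inner_symm := fun x y => by simp [hsymm (y : E) x]
  re_inner_nonneg := fun x => by
    by_cases hx : (x : E) = 0
    · simp [hx]
    · simpa using (hpos x hx).le
  add_left := fun x y z => by simp
  smul_left := fun x y r => by simp
  definite := fun x hx => by
    by_contra hne
    exact (hpos x (by simpa using hne)).ne' hx

/-- In a configuration of vectors in an open half space that is closed under differences at
acute angles and sums at obtuse angles, where the new vector has the colour of both its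
parents unless it is one of them, a pair `a`, `b` of different colours with `ζ b = 2 ζ a`
is orthogonal to everything else. -/
theorem orthogonal_of_eq_two_smul {ι : Type*} (Q : LinearMap.BilinForm ℝ E)
    (hpos : ∀ x, x ≠ 0 → 0 < Q x x)
    (f : E →ₗ[ℝ] ℝ) (ζ : ι → E) (hf : ∀ i, 0 < f (ζ i)) (μ : ι → ℝ)
    (hacute : ∀ a b, a ≠ b → 0 < Q (ζ a) (ζ b) → ∃ d,
      (ζ d = ζ a - ζ b ∨ ζ d = ζ b - ζ a) ∧ (d = a ∨ d = b ∨ (μ a = μ b ∧ μ d = μ a)))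
    (hobtuse : ∀ a b, a ≠ b → Q (ζ a) (ζ b) < 0 → ∃ d,
      ζ d = ζ a + ζ b ∧ (d = a ∨ d = b ∨ (μ a = μ b ∧ μ d = μ a)))
    {a b : ι} (hμ : μ a ≠ μ b) (hab : ζ b = (2 : ℝ) • ζ a) {l : ι} (hla : l ≠ a) (hlb : l ≠ b) :
    Q (ζ l) (ζ a) = 0 := by
  have hne : ∀ i, 0 < Q (ζ i) (ζ i) := fun i =>
    hpos _ fun h => (hf i).ne' (by rw [h, map_zero])
  have hinj : ∀ i j, ζ i = ζ j → i = j := by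
    intro i j h
    by_contra hij
    obtain ⟨d, hd, -⟩ := hacute i j hij (by rw [h]; exact hne j)
    have := hf d
    rcases hd with hd | hd <;> rw [hd, h, sub_self, map_zero] at this <;> exact this.false
  have hratio : ∀ i j, μ i ≠ μ j → Q (ζ i) (ζ j) ≠ 0 →
      ζ j = (2 : ℝ) • ζ i ∨ ζ i = (2 : ℝ) • ζ j := by
    intro i j hij hQ
    have hij' : i ≠ j := fun h => hij (by rw [h])
    have hi := hf i
    have hj := hf j
    rcases lt_or_gt_of_ne hQ with hQ | hQ
    · obtain ⟨d, hd, rfl | rfl | ⟨h, -⟩⟩ := hobtuse i j hij' hQ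
      · have := congrArg f hd
        rw [map_add] at this
        linarith
      · have := congrArg f hd
        rw [map_add] at this
        linarith
      · exact absurd h hij
    · obtain ⟨d, hd | hd, rfl | rfl | ⟨h, -⟩⟩ := hacute i j hij' hQ
      · have := congrArg f hd
        rw [map_sub] at this
        linarith
      · right
        rw [two_smul]
        nth_rewrite 2 [hd]
        abel
      · exact absurd h hij
      · left
        rw [two_smul]
        nth_rewrite 2 [hd]
        abel
      · have := congrArg f hd
        rw [map_sub] at this
        linarith
      · exact absurd h hij
  have ha := hf a
  have hfab := congrArg f hab
  rw [map_smul, smul_eq_mul] at hfab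
  by_contra hQ
  have hQb : Q (ζ l) (ζ b) ≠ 0 := by
    rw [hab, map_smul, smul_eq_mul]
    exact mul_ne_zero two_ne_zero hQ
  -- three vectors in ratio `1 : 2 : 4` with the middle one of a different colour
  have key : ∀ i j k, ζ j = (2 : ℝ) • ζ i → ζ k = (2 : ℝ) • ζ j → μ i ≠ μ j → μ k ≠ μ j →
      False := by
    intro i j k hj hk hij hkj
    have hi := hf i
    have e1 := congrArg f hj
    have e2 := congrArg f hk
    rw [map_smul, smul_eq_mul] at e1 e2
    have hki : k ≠ i := by rintro rfl; linarith
    have hkiQ : 0 < Q (ζ k) (ζ i) := by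
      rw [hk, hj]
      simp only [map_smul, LinearMap.smul_apply, smul_eq_mul]
      linarith [hne i]
    obtain ⟨d, hd | hd, h⟩ := hacute k i hki hkiQ
    · have hfd := congrArg f hd
      rw [map_sub] at hfd
      rcases h with rfl | rfl | ⟨-, h⟩
      · linarith
      · linarith
      · have hdj : 0 < Q (ζ d) (ζ j) := by
          rw [hd, hk, hj]
          simp only [map_smul, map_sub, LinearMap.sub_apply, LinearMap.smul_apply, smul_eq_mul]
          linarith [hne i]
        rcases hratio d j (h ▸ hkj) hdj.ne' with e | e <;>
        · have := congrArg f e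
          rw [map_smul, smul_eq_mul] at this
          linarith
    · have := congrArg f hd
      rw [map_sub] at this
      linarith [hf d]
  have hcase : μ l ≠ μ b ∨ μ l ≠ μ a := by
    by_contra! h
    exact hμ (h.2.symm.trans h.1)
  rcases hcase with h | h
  · rcases hratio l b h hQb with e | e
    · rw [hab] at e
      exact hla (hinj _ _ (smul_right_injective E (two_ne_zero (α := ℝ)) e).symm)
    · exact key a b l hab e hμ h
  · rcases hratio l a h hQ with e | e
    · exact key l a b e hab h (Ne.symm hμ)
    · exact hlb (hinj _ _ (e.trans hab.symm))

variable [FiniteDimensional ℝ E]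

/-- Every subspace has an orthonormal basis for a positive definite symmetric form. -/
theorem exists_orthonormal_family (Q : LinearMap.BilinForm ℝ E)
    (hsymm : ∀ x y, Q x y = Q y x) (hpos : ∀ x, x ≠ 0 → 0 < Q x x) (W : Submodule ℝ E) :
    ∃ (n : ℕ) (e : Fin n → E), (∀ i, e i ∈ W) ∧
      (∀ i j, Q (e i) (e j) = if i = j then 1 else 0) ∧
      ∀ x ∈ W, ∑ i, Q (e i) x • e i = x := by
  let core := innerCoreOfPosDef Q hsymm hpos W
  let _ : NormedAddCommGroup W := core.toNormedAddCommGroup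
  let _ : InnerProductSpace ℝ W := InnerProductSpace.ofCore core.toCore
  let b := stdOrthonormalBasis ℝ W
  refine ⟨_, fun i => (b i : E), fun i => (b i).2, fun i j => ?_, fun x hx => ?_⟩
  · exact orthonormal_iff_ite.mp b.orthonormal i j
  · have h := congrArg W.subtype (b.sum_repr' ⟨x, hx⟩)
    rw [map_sum] at h
    exact h

/-- Orthogonal projection onto a subspace for a positive definite symmetric form. -/
theorem exists_orthogonal_projection (Q : LinearMap.BilinForm ℝ E)
    (hsymm : ∀ x y, Q x y = Q y x) (hpos : ∀ x, x ≠ 0 → 0 < Q x x) (W : Submodule ℝ E) :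
    ∃ P : E →ₗ[ℝ] E, (∀ x, P x ∈ W) ∧ ∀ x, ∀ u ∈ W, Q (P x) u = Q x u := by
  obtain ⟨n, e, heW, -, hexp⟩ := exists_orthonormal_family Q hsymm hpos W
  refine ⟨∑ i, (Q (e i)).smulRight (e i), fun x => ?_, fun x u hu => ?_⟩
  · simp only [LinearMap.sum_apply, LinearMap.smulRight_apply]
    exact W.sum_mem fun i _ => W.smul_mem _ (heW i)
  · conv_rhs => rw [← hexp u hu]
    simp only [LinearMap.sum_apply, LinearMap.smulRight_apply, map_sum, map_smul,
      LinearMap.smul_apply, smul_eq_mul]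
    exact Finset.sum_congr rfl fun i _ => by rw [hsymm x (e i), mul_comm]

/-- A self-adjoint operator on a nonzero subspace has an eigenvector there. -/
theorem exists_eigenvector_of_symmetric (Q : LinearMap.BilinForm ℝ E)
    (hsymm : ∀ x y, Q x y = Q y x) (hpos : ∀ x, x ≠ 0 → 0 < Q x x) (W : Submodule ℝ E)
    (hW : W ≠ ⊥) (T : E →ₗ[ℝ] E) (hT : ∀ x ∈ W, T x ∈ W)
    (hTsymm : ∀ x ∈ W, ∀ y ∈ W, Q (T x) y = Q x (T y)) :
    ∃ c : ℝ, ∃ x ∈ W, x ≠ 0 ∧ T x = c • x := by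
  let core := innerCoreOfPosDef Q hsymm hpos W
  let _ : NormedAddCommGroup W := core.toNormedAddCommGroup
  let _ : InnerProductSpace ℝ W := InnerProductSpace.ofCore core.toCore
  have : Nontrivial W := Submodule.nontrivial_iff_ne_bot.mpr hW
  have hS : (T.restrict hT).IsSymmetric := fun x y => hTsymm x x.2 y y.2
  obtain ⟨v, hv⟩ := hS.hasEigenvalue_iSup_of_finiteDimensional.exists_hasEigenvector
  exact ⟨_, v, v.2, by simpa using hv.2, congrArg W.subtype hv.apply_eq_smul⟩

end PosDefForm

section FlagDecomposition

variable {𝔤 : Type*} [LieRing 𝔤] [LieAlgebra ℝ 𝔤]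

/-- The decomposition `𝔤 = 𝔨 ⊕ ⨁ mᵢ` of a Lie algebra with a positive definite invariant form,
where `𝔨` is the centralizer of `s₀` and the `mᵢ` are mutually orthogonal irreducible
`𝔨`-modules. -/
structure IsFlagDecomposition {ι : Type*} (Q : LinearMap.BilinForm ℝ 𝔤) (s₀ : 𝔤)
    (k : LieSubalgebra ℝ 𝔤) (m : ι → Submodule ℝ 𝔤) : Prop where
  symm : ∀ x y, Q x y = Q y x
  pos : ∀ x, x ≠ 0 → 0 < Q x x
  inv : ∀ x y z, Q ⁅x, y⁆ z = Q x ⁅y, z⁆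
  mem_iff : ∀ x, x ∈ k ↔ ⁅s₀, x⁆ = 0
  orth_k : ∀ i, ∀ x ∈ k, ∀ y ∈ m i, Q x y = 0
  orth : ∀ i j, i ≠ j → ∀ x ∈ m i, ∀ y ∈ m j, Q x y = 0
  irr : ∀ i, AdIrreducible k (m i)
  span : k.toSubmodule ⊔ ⨆ i, m i = ⊤

/-- `z` lies in the centre of the subalgebra `k`. -/
def IsCentralIn (k : LieSubalgebra ℝ 𝔤) (z : 𝔤) : Prop :=
  z ∈ k ∧ ∀ w ∈ k, ⁅w, z⁆ = 0

/-- On `W` the centre of `k` acts by multiples of the complex structure `J`, with weight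
represented by the central element `ζ`, which is the average of `⁅e, J e⁆`. -/
structure IsWeight (Q : LinearMap.BilinForm ℝ 𝔤) (k : LieSubalgebra ℝ 𝔤)
    (W : Submodule ℝ 𝔤) (J : 𝔤 →ₗ[ℝ] 𝔤) (ζ : 𝔤) : Prop where
  map_mem : ∀ x ∈ W, J x ∈ W
  map_map : ∀ x ∈ W, J (J x) = -x
  central : IsCentralIn k ζ
  lie_eq : ∀ z, IsCentralIn k z → ∀ x ∈ W, ⁅z, x⁆ = Q ζ z • J x
  average : ∃ (n : ℕ) (e : Fin n → 𝔤), 0 < n ∧ (∀ i, e i ∈ W) ∧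
    ∑ i, ⁅e i, J (e i)⁆ = (n : ℝ) • ζ

/-- A self-adjoint operator commuting with an irreducible action is a scalar. -/
theorem AdIrreducible.exists_eq_smul [FiniteDimensional ℝ 𝔤] {k : LieSubalgebra ℝ 𝔤}
    {W : Submodule ℝ 𝔤} (hW : AdIrreducible k W) (Q : LinearMap.BilinForm ℝ 𝔤)
    (hsymm : ∀ x y, Q x y = Q y x) (hpos : ∀ x, x ≠ 0 → 0 < Q x x)
    (T : 𝔤 →ₗ[ℝ] 𝔤) (hT : ∀ x ∈ W, T x ∈ W)
    (hTsymm : ∀ x ∈ W, ∀ y ∈ W, Q (T x) y = Q x (T y))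
    (hTk : ∀ w ∈ k, ∀ x ∈ W, T ⁅w, x⁆ = ⁅w, T x⁆) :
    ∃ c : ℝ, ∀ x ∈ W, T x = c • x := by
  obtain ⟨c, v, hv, hv0, hTv⟩ := exists_eigenvector_of_symmetric Q hsymm hpos W hW.2.1 T hT hTsymm
  refine ⟨c, ?_⟩
  let U : Submodule ℝ 𝔤 := W ⊓ LinearMap.ker (T - c • LinearMap.id)
  have hU : ∀ x, x ∈ U ↔ x ∈ W ∧ T x = c • x := fun x => by simp [U, sub_eq_zero]
  have hinv : AdInvariant k U := fun w hw x hx => by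
    rw [hU] at hx ⊢
    exact ⟨hW.1 w hw x hx.1, by rw [hTk w hw x hx.1, hx.2, lie_smul]⟩
  rcases hW.2.2 U inf_le_left hinv with h | h
  · exact absurd ((Submodule.mem_bot ℝ).mp (h ▸ (hU v).mpr ⟨hv, hTv⟩)) hv0
  · intro x hx
    exact ((hU x).mp (h.symm ▸ hx)).2

theorem IsCentralIn.lie_lie_comm {k : LieSubalgebra ℝ 𝔤} {z w : 𝔤} (hz : IsCentralIn k z)
    (hw : w ∈ k) (x : 𝔤) : ⁅z, ⁅w, x⁆⁆ = ⁅w, ⁅z, x⁆⁆ := by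
  rw [leibniz_lie, ← lie_skew z w, hz.2 w hw, neg_zero, zero_lie, zero_add]

namespace IsFlagDecomposition

variable {ι : Type*} {Q : LinearMap.BilinForm ℝ 𝔤} {s₀ : 𝔤} {k : LieSubalgebra ℝ 𝔤}
  {m : ι → Submodule ℝ 𝔤}

theorem skew (h : IsFlagDecomposition Q s₀ k m) (w x y : 𝔤) : Q ⁅w, x⁆ y = -Q x ⁅w, y⁆ := by
  rw [← lie_skew, map_neg, LinearMap.neg_apply, h.inv]

theorem central (h : IsFlagDecomposition Q s₀ k m) : IsCentralIn k s₀ :=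
  ⟨(h.mem_iff _).mpr (lie_self _),
    fun w hw => by rw [← lie_skew, (h.mem_iff w).mp hw, neg_zero]⟩

/-- A vector orthogonal to `k` and to all the `m i` vanishes. -/
theorem eq_zero (h : IsFlagDecomposition Q s₀ k m) {v : 𝔤} (hk : ∀ u ∈ k, Q v u = 0)
    (hm : ∀ i, ∀ u ∈ m i, Q v u = 0) : v = 0 := by
  have htop : k.toSubmodule ⊔ ⨆ i, m i ≤ LinearMap.ker (Q v) :=
    sup_le (fun u hu => hk u hu) (iSup_le fun i u hu => hm i u hu)
  rw [h.span] at htop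
  by_contra hv
  exact (h.pos v hv).ne' (htop Submodule.mem_top)

/-- The centre of `k` acts on `m i` through a single complex structure. -/
theorem exists_complex_structure [FiniteDimensional ℝ 𝔤] (h : IsFlagDecomposition Q s₀ k m)
    (i : ι) :
    ∃ (c : ℝ) (J : 𝔤 →ₗ[ℝ] 𝔤), 0 < c ∧ (∀ x, ⁅s₀, x⁆ = c • J x) ∧
      ∀ x ∈ m i, J (J x) = -x := by
  have hs := h.central
  have hinv := (h.irr i).1
  let D : 𝔤 →ₗ[ℝ] 𝔤 := LieAlgebra.ad ℝ 𝔤 s₀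
  have hD : ∀ x, D x = ⁅s₀, x⁆ := fun x => rfl
  obtain ⟨t, ht⟩ := (h.irr i).exists_eq_smul Q h.symm h.pos (D ∘ₗ D)
    (fun x hx => hinv _ hs.1 _ (hinv _ hs.1 x hx))
    (fun x _ y _ => by
      simp only [LinearMap.comp_apply, hD]
      rw [h.skew, h.skew, neg_neg])
    (fun w hw x _ => by
      simp only [LinearMap.comp_apply, hD]
      rw [hs.lie_lie_comm hw, hs.lie_lie_comm hw])
  simp only [LinearMap.comp_apply, hD] at ht
  obtain ⟨v, hv, hv0⟩ := Submodule.exists_mem_ne_zero_of_ne_bot (h.irr i).2.1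
  have hDv : ⁅s₀, v⁆ ≠ 0 := fun h0 =>
    (h.pos v hv0).ne' (h.orth_k i v ((h.mem_iff v).mpr h0) v hv)
  have ht0 : 0 < -t := by
    have h1 := h.pos _ hDv
    rw [h.skew, ht v hv, map_smul, smul_eq_mul, ← neg_mul] at h1
    exact pos_of_mul_pos_left h1 (h.pos v hv0).le
  have hc := Real.sqrt_pos.mpr ht0
  refine ⟨√(-t), (√(-t))⁻¹ • D, hc, fun x => ?_, fun x hx => ?_⟩
  · rw [LinearMap.smul_apply, smul_inv_smul₀ hc.ne', hD]
  · simp only [LinearMap.smul_apply, map_smul, hD]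
    rw [ht x hx, smul_smul, smul_smul, ← mul_inv, Real.mul_self_sqrt ht0.le, inv_mul_eq_div,
      div_neg, div_self (by linarith), neg_one_smul]

/-- The weight of the centre of `k` on `m i`. -/
theorem exists_isWeight [FiniteDimensional ℝ 𝔤] (h : IsFlagDecomposition Q s₀ k m) (i : ι) :
    ∃ (J : 𝔤 →ₗ[ℝ] 𝔤) (ζ : 𝔤), IsWeight Q k (m i) J ζ ∧ 0 < Q ζ s₀ := by
  have hs := h.central
  have hinv := (h.irr i).1
  obtain ⟨c, J, hc, hcJ, hJJ⟩ := h.exists_complex_structure i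
  have hJ : ∀ x, J x = c⁻¹ • ⁅s₀, x⁆ := fun x => by rw [hcJ, inv_smul_smul₀ hc.ne']
  have hJm : ∀ x ∈ m i, J x ∈ m i := fun x hx => by
    rw [hJ]
    exact (m i).smul_mem _ (hinv _ hs.1 x hx)
  have hJk : ∀ w ∈ k, ∀ x, J ⁅w, x⁆ = ⁅w, J x⁆ := fun w hw x => by
    rw [hJ, hJ, lie_smul, hs.lie_lie_comm hw]
  have hJskew : ∀ x y, Q (J x) y = -Q x (J y) := fun x y => by
    rw [hJ, hJ, map_smul, map_smul, LinearMap.smul_apply, h.skew, smul_neg]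
  have hrep : ∀ z, IsCentralIn k z → ∃ r : ℝ, ∀ x ∈ m i, ⁅z, x⁆ = r • J x := by
    intro z hz
    let T : 𝔤 →ₗ[ℝ] 𝔤 := (LieAlgebra.ad ℝ 𝔤 z : 𝔤 →ₗ[ℝ] 𝔤) ∘ₗ J
    have hT : ∀ x, T x = ⁅z, J x⁆ := fun x => rfl
    obtain ⟨t, ht⟩ := (h.irr i).exists_eq_smul Q h.symm h.pos T
      (fun x hx => hinv _ hz.1 _ (hJm x hx))
      (fun x _ y _ => by rw [hT, hT, h.skew, hJskew, neg_neg, hJk z hz.1])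
      (fun w hw x _ => by rw [hT, hT, hJk w hw, hz.lie_lie_comm hw])
    refine ⟨-t, fun x hx => ?_⟩
    have := ht (J x) (hJm x hx)
    rw [hT, hJJ x hx, lie_neg] at this
    rw [neg_smul, ← this, neg_neg]
  obtain ⟨n, e, hem, heo, hexp⟩ := exists_orthonormal_family Q h.symm h.pos (m i)
  have hn : 0 < n := by
    rcases Nat.eq_zero_or_pos n with rfl | hn
    · obtain ⟨v, hv, hv0⟩ := Submodule.exists_mem_ne_zero_of_ne_bot (h.irr i).2.1
      exact absurd (by simpa using (hexp v hv).symm) hv0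
    · exact hn
  have hn' : (n : ℝ) ≠ 0 := Nat.cast_ne_zero.mpr hn.ne'
  set Z : 𝔤 := ∑ p, ⁅e p, J (e p)⁆ with hZ
  have hZk : Z ∈ k := by
    rw [h.mem_iff, hZ, lie_sum]
    refine Finset.sum_eq_zero fun p _ => ?_
    rw [leibniz_lie, hcJ, hcJ, hJJ _ (hem p), smul_lie, lie_self, lie_smul, lie_neg, lie_self]
    simp
  have hZc : ∀ w ∈ k, ⁅w, Z⁆ = 0 := by
    intro w hw
    have hexp' : ∀ p, ⁅w, e p⁆ = ∑ q, Q (e q) ⁅w, e p⁆ • e q := fun p =>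
      (hexp _ (hinv w hw _ (hem p))).symm
    have h1 : ∑ p, ⁅⁅w, e p⁆, J (e p)⁆ = ∑ p, ∑ q, Q (e q) ⁅w, e p⁆ • ⁅e q, J (e p)⁆ :=
      Finset.sum_congr rfl fun p _ => by
        conv_lhs => rw [hexp' p]
        rw [sum_lie]
        exact Finset.sum_congr rfl fun q _ => by rw [smul_lie]
    have h2 : ∑ p, ⁅e p, ⁅w, J (e p)⁆⁆ = ∑ p, ∑ q, Q (e q) ⁅w, e p⁆ • ⁅e p, J (e q)⁆ :=
      Finset.sum_congr rfl fun p _ => by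
        rw [← hJk w hw]
        conv_lhs => rw [hexp' p]
        rw [map_sum, lie_sum]
        exact Finset.sum_congr rfl fun q _ => by rw [map_smul, lie_smul]
    rw [hZ, lie_sum]
    simp only [leibniz_lie w]
    rw [Finset.sum_add_distrib, h1, h2, Finset.sum_comm, ← Finset.sum_add_distrib]
    refine Finset.sum_eq_zero fun p _ => ?_
    rw [← Finset.sum_add_distrib]
    refine Finset.sum_eq_zero fun q _ => ?_
    rw [h.symm (e p), h.skew, neg_smul, neg_add_cancel]
  have hζ : IsCentralIn k ((n : ℝ)⁻¹ • Z) :=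
    ⟨k.smul_mem _ hZk, fun w hw => by rw [lie_smul, hZc w hw, smul_zero]⟩
  have hQ : ∀ z, ∀ r : ℝ, (∀ x ∈ m i, ⁅z, x⁆ = r • J x) → Q ((n : ℝ)⁻¹ • Z) z = r := by
    intro z r hr
    have : ∀ p, Q ⁅e p, J (e p)⁆ z = r := fun p => by
      rw [h.inv, ← lie_skew, hr _ (hJm _ (hem p)), hJJ _ (hem p), smul_neg, neg_neg, map_smul,
        heo, if_pos rfl, smul_eq_mul, mul_one]
    rw [map_smul, LinearMap.smul_apply, hZ, map_sum, LinearMap.sum_apply]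
    simp only [this]
    rw [Finset.sum_const, Finset.card_univ, Fintype.card_fin, nsmul_eq_mul, smul_eq_mul,
      inv_mul_cancel_left₀ hn']
  refine ⟨J, (n : ℝ)⁻¹ • Z, ⟨hJm, hJJ, hζ, fun z hz x hx => ?_, n, e, hn, hem, ?_⟩, ?_⟩
  · obtain ⟨r, hr⟩ := hrep z hz
    rw [hQ z r hr, hr x hx]
  · rw [smul_inv_smul₀ hn']
  · rw [hQ s₀ c fun x _ => hcJ x]
    exact hc

/-- If the `ε`-part of the bracket `m a × m b → m d` is nonzero, then `ζa + ε ζb = ± ζd`. -/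
theorem weight_add_eq (h : IsFlagDecomposition Q s₀ k m) {a b d : ι}
    {Ja Jb Jd : 𝔤 →ₗ[ℝ] 𝔤} {ζa ζb ζd : 𝔤} (ha : IsWeight Q k (m a) Ja ζa)
    (hb : IsWeight Q k (m b) Jb ζb) (hd : IsWeight Q k (m d) Jd ζd) {ε : ℝ} (hε : ε * ε = 1)
    {x y u : 𝔤} (hx : x ∈ m a) (hy : y ∈ m b) (hu : u ∈ m d)
    (hne : Q (⁅x, y⁆ - ε • ⁅Ja x, Jb y⁆) u ≠ 0) :
    ζd = ζa + ε • ζb ∨ ζd = -(ζa + ε • ζb) := by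
  set v := ζa + ε • ζb with hv
  have hvc : IsCentralIn k v :=
    ⟨k.add_mem ha.central.1 (k.smul_mem _ hb.central.1), fun w hw => by
      rw [hv, lie_add, lie_smul, ha.central.2 w hw, hb.central.2 w hw, smul_zero, add_zero]⟩
  have hsq : ∀ z, IsCentralIn k z → Q v z ^ 2 = Q ζd z ^ 2 := by
    intro z hz
    set P := ⁅x, y⁆ - ε • ⁅Ja x, Jb y⁆ with hP
    have hxa := ha.lie_eq z hz x hx
    have hxa' := ha.lie_eq z hz _ (ha.map_mem x hx)
    have hyb := hb.lie_eq z hz y hy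
    have hyb' := hb.lie_eq z hz _ (hb.map_mem y hy)
    rw [ha.map_map x hx] at hxa'
    rw [hb.map_map y hy] at hyb'
    have hzzP : ⁅z, ⁅z, P⁆⁆ = -(Q v z ^ 2) • P := by
      have hvz : Q v z = Q ζa z + ε * Q ζb z := by simp [hv]
      rw [hvz, hP]
      simp only [lie_sub, lie_add, lie_smul, leibniz_lie z, hxa, hxa', hyb, hyb', smul_lie,
        neg_lie, lie_neg, smul_neg]
      match_scalars
      · linear_combination (Q ζb z ^ 2) * hε
      · linear_combination -(2 * Q ζa z * Q ζb z + Q ζb z ^ 2 * ε) * hε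
    have hzzu : ⁅z, ⁅z, u⁆⁆ = -(Q ζd z ^ 2) • u := by
      rw [hd.lie_eq z hz u hu, lie_smul, hd.lie_eq z hz _ (hd.map_mem u hu), hd.map_map u hu]
      module
    have h1 : Q ⁅z, ⁅z, P⁆⁆ u = Q P ⁅z, ⁅z, u⁆⁆ := by rw [h.skew, h.skew, neg_neg]
    rw [hzzP, hzzu, map_smul, map_smul, LinearMap.smul_apply, smul_eq_mul, smul_eq_mul] at h1
    exact neg_injective (mul_right_cancel₀ hne h1)
  have e1 := hsq v hvc
  have e2 := hsq ζd hd.central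
  rw [h.symm ζd v] at e1
  have hnn : ∀ x, 0 ≤ Q x x := fun x => by
    by_cases hx : x = 0
    · simp [hx]
    · exact (h.pos x hx).le
  have e3 : Q v v = Q ζd ζd :=
    (pow_left_inj₀ (hnn _) (hnn _) two_ne_zero).mp (e1.trans e2)
  have hzero : ∀ x, Q x x = 0 → x = 0 := fun x hx => by
    by_contra hne
    exact (h.pos x hne).ne' hx
  rcases sq_eq_sq_iff_eq_or_eq_neg.mp e1 with e | e
  · left
    refine sub_eq_zero.mp (hzero _ ?_)
    simp only [map_sub, LinearMap.sub_apply, h.symm ζd v]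
    linarith
  · right
    refine eq_neg_of_add_eq_zero_left (hzero _ ?_)
    simp only [map_add, LinearMap.add_apply, h.symm ζd v]
    linarith

/-- If `ε ⟨ζa, ζb⟩ < 0`, the `ε`-part of the bracket `m a × m b → 𝔤` is nonzero. -/
theorem exists_lie_ne_zero (h : IsFlagDecomposition Q s₀ k m) {a b : ι}
    {Ja Jb : 𝔤 →ₗ[ℝ] 𝔤} {ζa ζb : 𝔤} (ha : IsWeight Q k (m a) Ja ζa)
    (hb : IsWeight Q k (m b) Jb ζb) {ε : ℝ} (hQ : ε * Q ζa ζb < 0) :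
    ∃ x ∈ m a, ∃ y ∈ m b, ⁅x, y⁆ - ε • ⁅Ja x, Jb y⁆ ≠ 0 := by
  by_contra! hall
  have hnn : ∀ x, 0 ≤ Q x x := fun x => by
    by_cases hx : x = 0
    · simp [hx]
    · exact (h.pos x hx).le
  have key : ∀ x ∈ m a, ∀ y ∈ m b, 0 ≤ ε * Q ⁅x, Ja x⁆ ⁅y, Jb y⁆ := by
    intro x hx y hy
    have h1 : ⁅x, y⁆ = ε • ⁅Ja x, Jb y⁆ := sub_eq_zero.mp (hall x hx y hy)
    have h2 := sub_eq_zero.mp (hall _ (ha.map_mem x hx) y hy)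
    rw [ha.map_map x hx, neg_lie, smul_neg] at h2
    have h3 : Q ⁅x, Ja x⁆ ⁅y, Jb y⁆ = Q ⁅x, y⁆ ⁅Ja x, Jb y⁆ - Q ⁅Ja x, y⁆ ⁅x, Jb y⁆ := by
      rw [← h.inv, lie_lie, map_sub, LinearMap.sub_apply, h.skew x, ← lie_skew (Ja x) ⁅x, y⁆,
        map_neg, LinearMap.neg_apply, h.inv ⁅x, y⁆]
      ring
    have h4 : ε * Q ⁅x, y⁆ ⁅Ja x, Jb y⁆ = Q ⁅x, y⁆ ⁅x, y⁆ := by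
      conv_rhs => rw [h1, map_smul, ← h1, smul_eq_mul]
    have h5 : ε * Q ⁅Ja x, y⁆ ⁅x, Jb y⁆ = -Q ⁅Ja x, y⁆ ⁅Ja x, y⁆ := by
      conv_rhs => rw [h2, map_neg, map_smul, ← h2, smul_eq_mul, neg_neg]
    rw [h3, mul_sub, h4, h5]
    linarith [hnn ⁅x, y⁆, hnn ⁅Ja x, y⁆]
  obtain ⟨n, e, hn, hem, havg⟩ := ha.average
  obtain ⟨y, hy, hy0⟩ := Submodule.exists_mem_ne_zero_of_ne_bot (h.irr b).2.1
  have hJy : Jb y ≠ 0 := fun h0 => hy0 (by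
    have := hb.map_map y hy
    rw [h0, map_zero] at this
    exact neg_eq_zero.mp this.symm)
  have hsum : 0 ≤ ε * Q ((n : ℝ) • ζa) ⁅y, Jb y⁆ := by
    rw [← havg, map_sum, LinearMap.sum_apply, Finset.mul_sum]
    exact Finset.sum_nonneg fun p _ => key _ (hem p) y hy
  rw [map_smul, LinearMap.smul_apply, ← h.inv, hb.lie_eq _ ha.central y hy, map_smul,
    LinearMap.smul_apply, smul_eq_mul, smul_eq_mul, h.symm ζb] at hsum
  have hpos : 0 < (n : ℝ) * Q (Jb y) (Jb y) := mul_pos (Nat.cast_pos.mpr hn) (h.pos _ hJy)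
  nlinarith

/-- In a simple Lie algebra the isotropy summands cannot be split into two commuting families. -/
theorem mem_of_lie_eq_zero [LieAlgebra.IsSimple ℝ 𝔤] (h : IsFlagDecomposition Q s₀ k m)
    {S : Set ι} (hS : S.Nonempty)
    (hcomm : ∀ a ∈ S, ∀ l ∉ S, ∀ x ∈ m a, ∀ y ∈ m l, ⁅x, y⁆ = 0) (l : ι) : l ∈ S := by
  by_contra hl
  let C : Submodule ℝ 𝔤 :=
    { carrier := {x | ∀ l ∉ S, ∀ y ∈ m l, ⁅x, y⁆ = 0}
      add_mem' := fun {x x'} hx hx' l hl y hy => by rw [add_lie, hx l hl y hy, hx' l hl y hy, add_zero]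
      zero_mem' := fun l _ y _ => zero_lie y
      smul_mem' := fun c x hx l hl y hy => by rw [smul_lie, hx l hl y hy, smul_zero] }
  have hC : ∀ x, x ∈ C ↔ ∀ l ∉ S, ∀ y ∈ m l, ⁅x, y⁆ = 0 := fun x => Iff.rfl
  let N : Submodule ℝ 𝔤 :=
    { carrier := {g | ∀ x ∈ C, ⁅g, x⁆ ∈ C}
      add_mem' := fun {g g'} hg hg' x hx => by
        rw [add_lie]
        exact C.add_mem (hg x hx) (hg' x hx)
      zero_mem' := fun x _ => by
        rw [zero_lie]
        exact C.zero_mem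
      smul_mem' := fun c g hg x hx => by
        rw [smul_lie]
        exact C.smul_mem c (hg x hx) }
  have hN : k.toSubmodule ⊔ ⨆ i, m i ≤ N := by
    refine sup_le (fun w hw x hx => ?_) (iSup_le fun i g hg x hx => ?_)
    · rw [hC] at hx ⊢
      intro l hl y hy
      rw [lie_lie, hx l hl y hy, hx l hl _ ((h.irr l).1 w hw y hy), lie_zero, sub_zero]
    · by_cases hi : i ∈ S
      · rw [hC] at hx ⊢
        intro l hl y hy
        rw [lie_lie, hx l hl y hy, hcomm i hi l hl g hg y hy, lie_zero, lie_zero, sub_zero]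
      · rw [← lie_skew, (hC x).mp hx i hi g hg, neg_zero]
        exact C.zero_mem
  let I : LieIdeal ℝ 𝔤 :=
    { C with
      lie_mem := fun {g x} hx => (hN (h.span ▸ Submodule.mem_top : g ∈ _)) x hx }
  have hI : ∀ x, x ∈ I ↔ ∀ l ∉ S, ∀ y ∈ m l, ⁅x, y⁆ = 0 := fun x => Iff.rfl
  rcases LieAlgebra.IsSimple.eq_bot_or_eq_top (R := ℝ) I with h0 | h1
  · obtain ⟨a, ha⟩ := hS
    obtain ⟨x, hx, hx0⟩ := Submodule.exists_mem_ne_zero_of_ne_bot (h.irr a).2.1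
    have : x ∈ I := (hI x).mpr fun l hl y hy => hcomm a ha l hl x hx y hy
    rw [h0] at this
    exact hx0 ((LieSubmodule.mem_bot x).mp this)
  · obtain ⟨y, hy, hy0⟩ := Submodule.exists_mem_ne_zero_of_ne_bot (h.irr l).2.1
    have hs : s₀ ∈ I := h1 ▸ LieSubmodule.mem_top s₀
    exact (h.pos y hy0).ne' (h.orth_k l y ((h.mem_iff y).mpr ((hI s₀).mp hs l hl y hy)) y hy)

/-- A colouring of at least three isotropy summands such that only triples of one colour
interact is constant. -/
theorem colour_const [FiniteDimensional ℝ 𝔤] [LieAlgebra.IsSimple ℝ 𝔤]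
    (h : IsFlagDecomposition Q s₀ k m) (hthree : ∀ a b : ι, ∃ l, l ≠ a ∧ l ≠ b) (μ : ι → ℝ)
    (hμ : ∀ a b d, a ≠ b → d ≠ a → d ≠ b → ∀ x ∈ m a, ∀ y ∈ m b, ∀ u ∈ m d,
      Q ⁅x, y⁆ u ≠ 0 → μ a = μ b) (i j : ι) : μ i = μ j := by
  choose J ζ hw hζ using h.exists_isWeight
  have hrel : ∀ a b, a ≠ b → ∀ ε : ℝ, ε * ε = 1 →
      (∃ x ∈ m a, ∃ y ∈ m b, ⁅x, y⁆ - ε • ⁅J a x, J b y⁆ ≠ 0) →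
      ∃ d, (ζ d = ζ a + ε • ζ b ∨ ζ d = -(ζ a + ε • ζ b)) ∧
        (d = a ∨ d = b ∨ (μ a = μ b ∧ μ d = μ a)) := by
    rintro a b hab ε hε ⟨x, hx, y, hy, hP⟩
    have hk : ∀ x ∈ m a, ∀ y ∈ m b, ∀ u ∈ k, Q ⁅x, y⁆ u = 0 := fun x hx y hy u hu => by
      rw [h.inv, ← lie_skew, map_neg, h.orth a b hab x hx _ ((h.irr b).1 u hu y hy), neg_zero]
    obtain ⟨d, u, hu, hne⟩ : ∃ d, ∃ u ∈ m d, Q (⁅x, y⁆ - ε • ⁅J a x, J b y⁆) u ≠ 0 := by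
      by_contra! hall
      refine hP (h.eq_zero (fun u hu => ?_) hall)
      simp [hk x hx y hy u hu,
        hk _ ((hw a).map_mem x hx) _ ((hw b).map_mem y hy) u hu]
    refine ⟨d, h.weight_add_eq (hw a) (hw b) (hw d) hε hx hy hu hne, ?_⟩
    by_cases hda : d = a
    · exact Or.inl hda
    by_cases hdb : d = b
    · exact Or.inr (Or.inl hdb)
    obtain ⟨x', hx', y', hy', hne'⟩ : ∃ x' ∈ m a, ∃ y' ∈ m b, Q ⁅x', y'⁆ u ≠ 0 := by
      by_contra! hall
      exact hne (by simp [hall x hx y hy,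
        hall _ ((hw a).map_mem x hx) _ ((hw b).map_mem y hy)])
    have h1 := hμ a b d hab hda hdb x' hx' y' hy' u hu hne'
    rw [h.inv, h.symm] at hne'
    have h2 := hμ b d a (Ne.symm hdb) hab (Ne.symm hda) y' hy' u hu x' hx' hne'
    exact Or.inr (Or.inr ⟨h1, (h1.trans h2).symm⟩)
  have hlie : ∀ a b, a ≠ b → ∀ x ∈ m a, ∀ y ∈ m b, ⁅x, y⁆ ≠ 0 → ∃ ε : ℝ, ε * ε = 1 ∧
      ∃ d, (ζ d = ζ a + ε • ζ b ∨ ζ d = -(ζ a + ε • ζ b)) ∧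
        (d = a ∨ d = b ∨ (μ a = μ b ∧ μ d = μ a)) := by
    intro a b hab x hx y hy hxy
    by_cases h1 : ⁅x, y⁆ - (1 : ℝ) • ⁅J a x, J b y⁆ = 0
    · refine ⟨-1, by norm_num, hrel a b hab _ (by norm_num) ⟨x, hx, y, hy, fun h2 => hxy ?_⟩⟩
      have h3 : (2 : ℝ) • ⁅x, y⁆ = 0 := by
        linear_combination (norm := module) h1 + h2
      exact (smul_eq_zero.mp h3).resolve_left two_ne_zero
    · exact ⟨1, by norm_num, hrel a b hab _ (by norm_num) ⟨x, hx, y, hy, h1⟩⟩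
  have hf : ∀ i, 0 < Q.flip s₀ (ζ i) := hζ
  have hacute : ∀ a b, a ≠ b → 0 < Q (ζ a) (ζ b) → ∃ d,
      (ζ d = ζ a - ζ b ∨ ζ d = ζ b - ζ a) ∧ (d = a ∨ d = b ∨ (μ a = μ b ∧ μ d = μ a)) := by
    intro a b hab hQ
    obtain ⟨d, hd, h'⟩ := hrel a b hab (-1) (by norm_num)
      (h.exists_lie_ne_zero (hw a) (hw b) (by linarith))
    refine ⟨d, ?_, h'⟩
    rwa [neg_one_smul, ← sub_eq_add_neg, neg_sub] at hd
  have hobtuse : ∀ a b, a ≠ b → Q (ζ a) (ζ b) < 0 → ∃ d,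
      ζ d = ζ a + ζ b ∧ (d = a ∨ d = b ∨ (μ a = μ b ∧ μ d = μ a)) := by
    intro a b hab hQ
    obtain ⟨d, hd, h'⟩ := hrel a b hab 1 (by norm_num)
      (h.exists_lie_ne_zero (hw a) (hw b) (by linarith))
    rw [one_smul] at hd
    refine ⟨d, hd.resolve_right fun e => ?_, h'⟩
    have := congrArg (Q.flip s₀) e
    rw [map_neg, map_add] at this
    linarith [hf a, hf b, hf d]
  by_contra hij
  obtain ⟨a, b, hab, hζab⟩ : ∃ a b, μ a ≠ μ b ∧ ζ b = (2 : ℝ) • ζ a := by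
    by_contra! hno
    refine hij (h.mem_of_lie_eq_zero (S := {l | μ l = μ i}) ⟨i, rfl⟩ ?_ j).symm
    intro a ha l hl x hx y hy
    by_contra hxy
    have hal : μ a ≠ μ l := fun e => hl (e.symm.trans ha)
    obtain ⟨ε, hε, d, hd, hd'⟩ := hlie a l (fun e => hal (by rw [e])) x hx y hy hxy
    have hε' : ε = 1 ∨ ε = -1 := mul_self_eq_one_iff.mp hε
    have hfa := hf a
    have hfl := hf l
    rcases hd' with rfl | rfl | ⟨e, -⟩
    · have hdf : ζ l = (2 : ℝ) • ζ d := by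
        rcases hd with hd | hd <;> rcases hε' with rfl | rfl
        all_goals have hdv := congrArg (Q.flip s₀) hd
        all_goals simp only [map_neg, map_add, map_smul, smul_eq_mul] at hdv
        all_goals first
          | exfalso; linarith
          | linear_combination (norm := module) -hd
      exact hno _ _ hal hdf
    · have hdf : ζ a = (2 : ℝ) • ζ d := by
        rcases hd with hd | hd <;> rcases hε' with rfl | rfl
        all_goals have hdv := congrArg (Q.flip s₀) hd
        all_goals simp only [map_neg, map_add, map_smul, smul_eq_mul] at hdv
        all_goals first
          | exfalso; linarith
          | linear_combination (norm := module) -hd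
      exact hno _ _ (Ne.symm hal) hdf
    · exact hal e
  have horth : ∀ l, l ≠ a → l ≠ b → Q (ζ l) (ζ a) = 0 := fun l hla hlb =>
    orthogonal_of_eq_two_smul Q h.pos (Q.flip s₀) ζ hf μ hacute hobtuse hab hζab hla hlb
  have hpair : ∀ c, c = a ∨ c = b → ∃ t : ℝ, t ≠ 0 ∧ ζ c = t • ζ a := by
    rintro c (rfl | rfl)
    · exact ⟨1, one_ne_zero, (one_smul ℝ _).symm⟩
    · exact ⟨2, two_ne_zero, hζab⟩
  have hne : ∀ i, Q (ζ i) (ζ i) ≠ 0 := fun i => (h.pos _ fun e => (hf i).ne' (by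
    rw [e, map_zero])).ne'
  obtain ⟨l₀, hl₀a, hl₀b⟩ := hthree a b
  have hmem := h.mem_of_lie_eq_zero (S := {c | c = a ∨ c = b}) ⟨a, Or.inl rfl⟩ (by
    intro c hc l hl x hx y hy
    by_contra hxy
    have hcl : c ≠ l := fun e => hl (e ▸ hc)
    obtain ⟨ε, hε, d, hd, -⟩ := hlie c l hcl x hx y hy hxy
    obtain ⟨t, ht, hct⟩ := hpair c hc
    have hla : Q (ζ l) (ζ a) = 0 := horth l (fun e => hl (Or.inl e)) fun e => hl (Or.inr e)
    have hal : Q (ζ a) (ζ l) = 0 := (h.symm _ _).trans hla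
    have hε0 : ε ≠ 0 := left_ne_zero_of_mul_eq_one hε
    by_cases hdab : d = a ∨ d = b
    · obtain ⟨t', -, hdt⟩ := hpair d hdab
      have hdl : Q (ζ d) (ζ l) = 0 := by simp [hdt, hal]
      rcases hd with hd | hd <;> simp [hd, hct, hal, hε0, hne] at hdl
    · have hda : Q (ζ d) (ζ a) = 0 :=
        horth d (fun e => hdab (Or.inl e)) fun e => hdab (Or.inr e)
      rcases hd with hd | hd <;> simp [hd, hct, hla, ht, hne] at hda) l₀
  exact hmem.elim hl₀a hl₀b

/-- An intertwining operator maps a summand equivalent to no other summand into itself. -/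
theorem map_mem_of_not_adEquiv [FiniteDimensional ℝ 𝔤] (h : IsFlagDecomposition Q s₀ k m)
    {i : ι} (hineq : ∀ j, j ≠ i → ¬ AdEquiv k (m i) (m j)) (A : 𝔤 →ₗ[ℝ] 𝔤)
    (hA : ∀ x ∈ m i, ∀ u ∈ k, Q (A x) u = 0)
    (hAk : ∀ w ∈ k, ∀ x ∈ m i, A ⁅w, x⁆ = ⁅w, A x⁆) (x : 𝔤) (hx : x ∈ m i) : A x ∈ m i := by
  have hzero : ∀ j, j ≠ i → ∀ x ∈ m i, ∀ u ∈ m j, Q (A x) u = 0 := by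
    intro j hj
    obtain ⟨P, hPm, hP⟩ := exists_orthogonal_projection Q h.symm h.pos (m j)
    have hPk : ∀ w ∈ k, ∀ x ∈ m i, P (A ⁅w, x⁆) = ⁅w, P (A x)⁆ := by
      intro w hw x hx
      have hmem : P (A ⁅w, x⁆) - ⁅w, P (A x)⁆ ∈ m j :=
        (m j).sub_mem (hPm _) ((h.irr j).1 w hw _ (hPm _))
      refine sub_eq_zero.mp (h.eq_zero (fun u hu => ?_) fun l u hu => ?_)
      · rw [h.symm]
        exact h.orth_k j u hu _ hmem
      · by_cases hl : j = l
        · subst hl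
          rw [map_sub, LinearMap.sub_apply, hP _ u hu, h.skew, hP _ _ ((h.irr j).1 w hw u hu),
            hAk w hw x hx, h.skew, sub_self]
        · exact h.orth j l hl _ hmem u hu
    let U : Submodule ℝ 𝔤 := m i ⊓ LinearMap.ker (P ∘ₗ A)
    have hU : ∀ x, x ∈ U ↔ x ∈ m i ∧ P (A x) = 0 := fun x => by simp [U]
    have hUinv : AdInvariant k U := fun w hw x hx => by
      rw [hU] at hx ⊢
      exact ⟨(h.irr i).1 w hw x hx.1, by rw [hPk w hw x hx.1, hx.2, lie_zero]⟩
    rcases (h.irr i).2.2 U inf_le_left hUinv with h0 | h1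
    · exfalso
      have hinj : ∀ x ∈ m i, (P ∘ₗ A) x = 0 → x = 0 := fun x hx h' =>
        (Submodule.mem_bot ℝ).mp (h0 ▸ (hU x).mpr ⟨hx, h'⟩)
      refine hineq j hj ⟨P ∘ₗ A, ?_, hinj, hPk⟩
      refine ((h.irr j).2.2 _ ?_ ?_).resolve_left fun hbot => ?_
      · rintro _ ⟨x, -, rfl⟩
        exact hPm _
      · rintro w hw _ ⟨x, hx, rfl⟩
        exact ⟨⁅w, x⁆, (h.irr i).1 w hw x hx, hPk w hw x hx⟩
      · obtain ⟨v, hv, hv0⟩ := Submodule.exists_mem_ne_zero_of_ne_bot (h.irr i).2.1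
        exact hv0 (hinj v hv ((Submodule.mem_bot ℝ).mp (hbot ▸ Submodule.mem_map_of_mem hv)))
    · intro x hx u hu
      rw [← hP _ u hu, ((hU x).mp (h1.symm ▸ hx)).2, map_zero, LinearMap.zero_apply]
  obtain ⟨P, hPm, hP⟩ := exists_orthogonal_projection Q h.symm h.pos (m i)
  have : A x - P (A x) = 0 := by
    refine h.eq_zero (fun u hu => ?_) fun l u hu => ?_
    · rw [map_sub, LinearMap.sub_apply, hA x hx u hu, h.symm, h.orth_k i u hu _ (hPm _), sub_zero]
    · by_cases hl : l = i
      · subst hl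
        rw [map_sub, LinearMap.sub_apply, hP _ u hu, sub_self]
      · rw [map_sub, LinearMap.sub_apply, hzero l hl x hx u hu,
          h.orth i l (Ne.symm hl) _ (hPm _) u hu, sub_zero]
  rw [sub_eq_zero.mp this]
  exact hPm _

end IsFlagDecomposition

end FlagDecomposition

/-- **Corollary 1** (Arvanitoyeorgos–Wang–Zhao).
Let `G/K` be a generalized flag manifold with `s ≥ 3` isotropy summands and `G/K₁` the
corresponding `M`-space.  If `dim 𝔰 = 1` and some summand `𝔪ⱼ` is reducible as an
`Ad(K₁)`-module, then `(G/K₁, g)` is a g.o. space if and only if `g` is the standard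
metric (i.e. the metric generated by `B(·,·)`, up to a positive scale). -/
theorem goMetric_iff_standard_of_dim_s_one
    {𝔤 : Type*} [LieRing 𝔤] [LieAlgebra ℝ 𝔤] [FiniteDimensional ℝ 𝔤]
    -- `G` is a compact simple Lie group: `𝔤` is simple with negative definite Killing form
    [LieAlgebra.IsSimple ℝ 𝔤]
    (hcompact : ∀ x : 𝔤, x ≠ 0 → killingForm ℝ 𝔤 x x < 0)
    (𝔨 𝔨₁ 𝔰 : LieSubalgebra ℝ 𝔤)
    -- `S` is a torus in `G` and `K = C(S)` is its centralizer
    (h𝔰ab : ∀ x ∈ 𝔰, ∀ y ∈ 𝔰, ⁅x, y⁆ = (0 : 𝔤))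
    (h𝔨cent : ∀ x : 𝔤, x ∈ 𝔨 ↔ ∀ s ∈ 𝔰, ⁅s, x⁆ = 0)
    -- `K = S × K₁`, `K₁` being the semisimple part of `K`
    (h𝔰𝔨 : 𝔰 ≤ 𝔨) (h𝔨₁𝔨 : 𝔨₁ ≤ 𝔨)
    (h𝔨sum : 𝔰.toSubmodule ⊔ 𝔨₁.toSubmodule = 𝔨.toSubmodule)
    (h𝔨disj : Disjoint 𝔰.toSubmodule 𝔨₁.toSubmodule)
    (h𝔰𝔨₁ : ∀ s ∈ 𝔰, ∀ k ∈ 𝔨₁, ⁅s, k⁆ = (0 : 𝔤))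
    (hder : ∀ x ∈ 𝔨, ∀ y ∈ 𝔨, ⁅x, y⁆ ∈ 𝔨₁)
    -- the `B`-orthogonal reductive decomposition `𝔤 = 𝔨 ⊕ 𝔪`, where `B = -Killing form`
    (𝔪 : Submodule ℝ 𝔤)
    (h𝔪compl : IsCompl 𝔨.toSubmodule 𝔪)
    (h𝔪orth : ∀ x ∈ 𝔨, ∀ y ∈ 𝔪, killingForm ℝ 𝔤 x y = 0)
    (h𝔪inv : AdInvariant 𝔨 𝔪)
    -- the decomposition `𝔪 = 𝔪₁ ⊕ ⋯ ⊕ 𝔪ₛ` with `s ≥ 3`, `B`-orthogonal, into pairwise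
    -- inequivalent irreducible `Ad(K)`-submodules
    (s : ℕ) (hs : 3 ≤ s) (m : Fin s → Submodule ℝ 𝔤)
    (hmsub : ∀ i, m i ≤ 𝔪)
    (hmsum : ⨆ i, m i = 𝔪)
    (hmorth : ∀ i j, i ≠ j → ∀ x ∈ m i, ∀ y ∈ m j, killingForm ℝ 𝔤 x y = 0)
    (hmirr : ∀ i, AdIrreducible 𝔨 (m i))
    (hmineq : ∀ i j, i ≠ j → ¬ AdEquiv 𝔨 (m i) (m j))
    -- `dim 𝔰 = 1`
    (hdim𝔰 : Module.finrank ℝ 𝔰 = 1)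
    -- some `𝔪ⱼ` is reducible as an `Ad(K₁)`-module
    (hredj : ∃ j : Fin s, AdReducible 𝔨₁ (m j))
    -- `Λ` is the associated operator of the `G`-invariant metric `g` on the `M`-space
    -- `G/K₁`, whose tangent space at the origin is `𝔫 = 𝔰 ⊕ 𝔪`:
    -- positive definite, symmetric w.r.t. `B = -Killing`, and `Ad(K₁)`-equivariant
    (Λ : 𝔤 →ₗ[ℝ] 𝔤)
    (hΛ𝔫 : ∀ x ∈ 𝔰.toSubmodule ⊔ 𝔪, Λ x ∈ 𝔰.toSubmodule ⊔ 𝔪)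
    (hΛsym : ∀ x ∈ 𝔰.toSubmodule ⊔ 𝔪, ∀ y ∈ 𝔰.toSubmodule ⊔ 𝔪,
      killingForm ℝ 𝔤 (Λ x) y = killingForm ℝ 𝔤 x (Λ y))
    (hΛpos : ∀ x ∈ 𝔰.toSubmodule ⊔ 𝔪, x ≠ 0 → 0 < -(killingForm ℝ 𝔤 (Λ x) x))
    (hΛequiv : ∀ k ∈ 𝔨₁, ∀ x ∈ 𝔰.toSubmodule ⊔ 𝔪, Λ ⁅k, x⁆ = ⁅k, Λ x⁆)
    :
    IsGOMetric 𝔨₁ (𝔰.toSubmodule ⊔ 𝔪) Λ ↔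
      ∃ c : ℝ, 0 < c ∧ ∀ x ∈ 𝔰.toSubmodule ⊔ 𝔪, Λ x = c • x := by
  obtain ⟨Q, hQ⟩ : ∃ Q : LinearMap.BilinForm ℝ 𝔤, ∀ x y, Q x y = -killingForm ℝ 𝔤 x y :=
    ⟨-killingForm ℝ 𝔤, fun _ _ => rfl⟩
  obtain ⟨⟨s₀, hs₀⟩, hs₀0, hspan⟩ := finrank_eq_one_iff'.mp hdim𝔰
  replace hs₀0 : s₀ ≠ 0 := fun e => hs₀0 (Subtype.ext e)
  replace hspan : ∀ x ∈ 𝔰, ∃ t : ℝ, t • s₀ = x := fun x hx => by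
    obtain ⟨t, ht⟩ := hspan ⟨x, hx⟩
    exact ⟨t, congrArg Subtype.val ht⟩
  have h : IsFlagDecomposition Q s₀ 𝔨 m :=
    { symm := fun x y => by rw [hQ, hQ, LieModule.traceForm_comm]
      pos := fun x hx => by
        rw [hQ]
        linarith [hcompact x hx]
      inv := fun x y z => by rw [hQ, hQ, LieModule.traceForm_apply_lie_apply]
      mem_iff := fun x => by
        refine (h𝔨cent x).trans ⟨fun hx => hx s₀ hs₀, fun hx s hs => ?_⟩
        obtain ⟨t, rfl⟩ := hspan s hs
        rw [smul_lie, hx, smul_zero]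
      orth_k := fun i x hx y hy => by rw [hQ, h𝔪orth x hx y (hmsub i hy), neg_zero]
      orth := fun i j hij x hx y hy => by rw [hQ, hmorth i j hij x hx y hy, neg_zero]
      irr := hmirr
      span := by rw [hmsum, h𝔪compl.sup_eq_top] }
  have hs₀n : s₀ ∈ 𝔰.toSubmodule ⊔ 𝔪 := Submodule.mem_sup_left hs₀
  have h𝔪n : ∀ y ∈ 𝔪, y ∈ 𝔰.toSubmodule ⊔ 𝔪 := fun y hy => Submodule.mem_sup_right hy
  have h𝔨𝔪 : ∀ x ∈ 𝔨, x ∈ 𝔪 → x = 0 := fun x hx hx' =>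
    Submodule.disjoint_def.mp h𝔪compl.disjoint x hx hx'
  have hQ𝔪 : ∀ x ∈ 𝔨, ∀ y ∈ 𝔪, Q x y = 0 := fun x hx y hy => by
    rw [hQ, h𝔪orth x hx y hy, neg_zero]
  constructor
  swap
  · rintro ⟨c, -, hc⟩ x hx
    exact ⟨0, 𝔨₁.zero_mem, by
      rw [zero_add, hc x hx, lie_smul, lie_self, smul_zero]
      exact 𝔨₁.zero_mem⟩
  intro hgo
  obtain ⟨c, hc⟩ : ∃ c : ℝ, Λ s₀ = c • s₀ := by
    obtain ⟨s', hs', v, hv, hsv⟩ := Submodule.mem_sup.mp (hΛ𝔫 s₀ hs₀n)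
    obtain ⟨c, rfl⟩ := hspan s' hs'
    obtain ⟨a, ha, hgo⟩ := hgo s₀ hs₀n
    have has : ⁅a, s₀⁆ = 0 := by rw [← lie_skew, h𝔰𝔨₁ s₀ hs₀ a ha, neg_zero]
    have hav : ⁅a, v⁆ = 0 := by
      have := hΛequiv a ha s₀ hs₀n
      rwa [has, map_zero, ← hsv, lie_add, lie_smul, has, smul_zero, zero_add, eq_comm] at this
    rw [← hsv, add_lie, lie_add, lie_add, lie_smul, lie_smul, has, hav, lie_self, smul_zero,
      zero_add, zero_add, zero_add] at hgo
    have hv0 := h𝔨𝔪 _ (h𝔨₁𝔨 hgo) (h𝔪inv s₀ h.central.1 v hv)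
    rw [h𝔨𝔪 v ((h.mem_iff v).mpr hv0) hv, add_zero] at hsv
    exact ⟨c, hsv.symm⟩
  have hc0 : 0 < c := by
    have := hΛpos s₀ hs₀n hs₀0
    rw [← hQ, hc, map_smul, LinearMap.smul_apply, smul_eq_mul] at this
    exact pos_of_mul_pos_left this (h.pos s₀ hs₀0).le
  have hΛQ : ∀ x ∈ 𝔰.toSubmodule ⊔ 𝔪, ∀ y ∈ 𝔰.toSubmodule ⊔ 𝔪, Q (Λ x) y = Q x (Λ y) :=
    fun x hx y hy => by rw [hQ, hQ, hΛsym x hx y hy]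
  have hΛ𝔪 : ∀ y ∈ 𝔪, Λ y ∈ 𝔪 := by
    intro y hy
    obtain ⟨s', hs', v, hv, hsv⟩ := Submodule.mem_sup.mp (hΛ𝔫 y (h𝔪n y hy))
    obtain ⟨t, rfl⟩ := hspan s' hs'
    have h1 := hΛQ s₀ hs₀n y (h𝔪n y hy)
    rw [hc, map_smul, LinearMap.smul_apply, hQ𝔪 s₀ h.central.1 y hy, smul_zero, ← hsv, map_add,
      hQ𝔪 s₀ h.central.1 v hv, add_zero, map_smul, smul_eq_mul, eq_comm] at h1
    rw [(mul_eq_zero.mp h1).resolve_right (h.pos s₀ hs₀0).ne', zero_smul, zero_add] at hsv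
    rwa [← hsv]
  have hΛs₀ : ∀ y ∈ 𝔪, Λ ⁅s₀, y⁆ = ⁅s₀, Λ y⁆ := by
    obtain ⟨P, hPm, hP⟩ := exists_orthogonal_projection Q h.symm h.pos 𝔨₁.toSubmodule
    set r := s₀ - P s₀ with hr
    have hr𝔨 : r ∈ 𝔨 := 𝔨.sub_mem h.central.1 (h𝔨₁𝔨 (hPm s₀))
    have hr𝔨₁ : ∀ u ∈ 𝔨₁, Q u r = 0 := fun u hu => by
      rw [h.symm, hr, map_sub, LinearMap.sub_apply, hP s₀ u hu, sub_self]
    have hdiag : ∀ y ∈ 𝔪, Q ⁅y, Λ y⁆ r = 0 := by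
      intro y hy
      obtain ⟨a, ha, hgo⟩ := hgo y (h𝔪n y hy)
      have h1 := hr𝔨₁ _ hgo
      rwa [add_lie, map_add, LinearMap.add_apply, h.symm ⁅a, Λ y⁆,
        hQ𝔪 r hr𝔨 _ (h𝔪inv a (h𝔨₁𝔨 ha) _ (hΛ𝔪 y hy)), zero_add] at h1
    have hr𝔪 : ∀ y ∈ 𝔪, Λ ⁅r, y⁆ = ⁅r, Λ y⁆ := by
      intro y hy
      have hry := h𝔪inv r hr𝔨 y hy
      have hv : Λ ⁅r, y⁆ - ⁅r, Λ y⁆ ∈ 𝔪 :=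
        𝔪.sub_mem (hΛ𝔪 _ hry) (h𝔪inv r hr𝔨 _ (hΛ𝔪 y hy))
      have hpol : ∀ y' ∈ 𝔪, Q y' (Λ ⁅r, y⁆ - ⁅r, Λ y⁆) = 0 := by
        intro y' hy'
        have h1 := hdiag _ (𝔪.add_mem hy hy')
        simp only [map_add, lie_add, add_lie, LinearMap.add_apply, hdiag y hy,
          hdiag y' hy'] at h1
        have h2 : Q ⁅y, Λ y'⁆ r = Q y' (Λ ⁅r, y⁆) := by
          rw [← lie_skew y, map_neg, LinearMap.neg_apply, h.inv, ← lie_skew y r, map_neg, neg_neg,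
            hΛQ y' (h𝔪n _ hy') _ (h𝔪n _ hry)]
        have h3 : Q ⁅y', Λ y⁆ r = -Q y' ⁅r, Λ y⁆ := by
          rw [h.inv, ← lie_skew (Λ y) r, map_neg]
        rw [map_sub]
        linarith
      by_contra hne
      exact (h.pos _ (sub_ne_zero.mpr hne)).ne' (hpol _ hv)
    intro y hy
    have hs₀r : s₀ = r + P s₀ := by rw [hr, sub_add_cancel]
    rw [hs₀r, add_lie, add_lie, map_add, hr𝔪 y hy, hΛequiv _ (hPm s₀) y (h𝔪n y hy)]
  have hΛ𝔨 : ∀ w ∈ 𝔨, ∀ y ∈ 𝔪, Λ ⁅w, y⁆ = ⁅w, Λ y⁆ := by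
    intro w hw y hy
    rw [← LieSubalgebra.mem_toSubmodule, ← h𝔨sum] at hw
    obtain ⟨s', hs', u, hu, rfl⟩ := Submodule.mem_sup.mp hw
    obtain ⟨t, rfl⟩ := hspan s' hs'
    rw [add_lie, add_lie, map_add, smul_lie, smul_lie, map_smul, hΛs₀ y hy,
      hΛequiv u hu y (h𝔪n y hy)]
  have hscalar : ∀ i, ∃ t : ℝ, ∀ x ∈ m i, Λ x = t • x := fun i =>
    (hmirr i).exists_eq_smul Q h.symm h.pos Λ
      (h.map_mem_of_not_adEquiv (fun j hj => hmineq i j hj.symm) Λ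
        (fun x hx u hu => by rw [h.symm, hQ𝔪 u hu _ (hΛ𝔪 x (hmsub i hx))])
        fun w hw x hx => hΛ𝔨 w hw x (hmsub i hx))
      (fun x hx y hy => hΛQ x (h𝔪n x (hmsub i hx)) y (h𝔪n y (hmsub i hy)))
      fun w hw x hx => hΛ𝔨 w hw x (hmsub i hx)
  choose μ hμ using hscalar
  have hconst : ∀ i j, μ i = μ j := by
    refine h.colour_const (fun a b => ?_) μ ?_
    · have hcard : ({a, b} : Finset (Fin s)).card < Fintype.card (Fin s) := by
        rw [Fintype.card_fin]
        exact (Finset.card_le_two).trans_lt hs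
      obtain ⟨l, hl⟩ := Finset.exists_mem_notMem_of_card_lt_card
        (s := {a, b}) (t := Finset.univ) hcard
      exact ⟨l, by simpa using hl⟩
    · intro a b d hab hda hdb x hx y hy u hu hne
      obtain ⟨w, hw, hgo⟩ := hgo (x + y)
        (h𝔪n _ (𝔪.add_mem (hmsub a hx) (hmsub b hy)))
      have h1 := hQ𝔪 _ (h𝔨₁𝔨 hgo) u (hmsub d hu)
      have hwx := h.orth a d hda.symm _ ((hmirr a).1 w (h𝔨₁𝔨 hw) x hx) u hu
      have hwy := h.orth b d hdb.symm _ ((hmirr b).1 w (h𝔨₁𝔨 hw) y hy) u hu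
      simp only [map_add, hμ a x hx, hμ b y hy, add_lie, lie_add, lie_smul, lie_self,
        map_smul, LinearMap.add_apply, LinearMap.smul_apply, smul_eq_mul, hwx, hwy, ← lie_skew y x, map_neg, LinearMap.neg_apply, zero_add, add_zero] at h1
      exact mul_right_cancel₀ hne (by linarith)
  obtain ⟨j, -, U, hUm, hU, hU0, hU1⟩ := hredj
  have hμc : μ j = c := by
    by_contra hne
    refine ((hmirr j).2.2 U hUm fun w hw y hy => ?_).elim hU0 hU1
    have hym := hUm hy
    have hs₀y : ⁅s₀, y⁆ ∈ U := by
      obtain ⟨a, ha, hgo⟩ := hgo (s₀ + y) (add_mem hs₀n (h𝔪n y (hmsub j hym)))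
      have has : ⁅a, s₀⁆ = 0 := by rw [← lie_skew, h𝔰𝔨₁ s₀ hs₀ a ha, neg_zero]
      have heq : ⁅a + (s₀ + y), Λ (s₀ + y)⁆ = μ j • ⁅a, y⁆ + (μ j - c) • ⁅s₀, y⁆ := by
        rw [map_add, hc, hμ j y hym]
        simp only [add_lie, lie_add, lie_smul, lie_self, has, ← lie_skew y s₀]
        module
      rw [heq] at hgo
      have hay := hU a ha y hy
      have hz := h𝔨𝔪 _ (h𝔨₁𝔨 hgo) (𝔪.add_mem
        (𝔪.smul_mem _ (h𝔪inv a (h𝔨₁𝔨 ha) y (hmsub j hym)))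
        (𝔪.smul_mem _ (h𝔪inv s₀ h.central.1 y (hmsub j hym))))
      rw [← U.smul_mem_iff (sub_ne_zero.mpr hne), eq_neg_of_add_eq_zero_right hz]
      exact U.neg_mem (U.smul_mem _ hay)
    rw [← LieSubalgebra.mem_toSubmodule, ← h𝔨sum] at hw
    obtain ⟨s', hs', u, hu, rfl⟩ := Submodule.mem_sup.mp hw
    obtain ⟨t, rfl⟩ := hspan s' hs'
    rw [add_lie, smul_lie]
    exact U.add_mem (U.smul_mem _ hs₀y) (hU u hu y hy)
  have hle : 𝔰.toSubmodule ⊔ 𝔪 ≤ LinearMap.ker (Λ - c • LinearMap.id) := by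
    rw [← hmsum]
    refine sup_le (fun x hx => ?_) (iSup_le fun i x hx => ?_)
    · obtain ⟨t, rfl⟩ := hspan x hx
      simp [hc]
    · simp [hμ i x hx, hconst i j, hμc]
  exact ⟨c, hc0, fun x hx => by simpa [sub_eq_zero] using hle hx⟩
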